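/- Let 𝒰 be a finite set and let S : Set 𝒰 → Σ be a monotone composable sketching map. Then for every σ in the image of S, all cores of σ have the same cardinality; moreover, for every A ⊆ 𝒰, all minimal elements (under inclusion) of the family {C ∖ A : C is a core of σ} have the same cardinality. -/

import Mathlib

/-- A sketching map `S` on ground set `𝒰` is *composable* if there is a binary
operation `op` on sketch values with `S (A ∪ B) = op (S A) (S B)` for all `A B`. -/
def Composable {𝒰 T : Type*} (S : Set 𝒰 → T) : Prop :=
  ∃ op : T → T → T, ∀ A B : Set 𝒰, S (A ∪ B) = op (S A) (S B)

/-- `C` is a *core* of the sketch value `σ`: `S C = σ` and no proper subset of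
`C` has sketch `σ`. -/
def IsCore {𝒰 T : Type*} (S : Set 𝒰 → T) (σ : T) (C : Set 𝒰) : Prop :=
  S C = σ ∧ ∀ C' : Set 𝒰, C' ⊂ C → S C' ≠ σ

/-- A composable map is *monotone* if for all `A` and `U₁ ⊆ U₂`, whenever
`Cᵢ ⊆ Uᵢ` is minimal with `S (Cᵢ ∪ A) = S (Uᵢ ∪ A)`, then `|C₁| ≤ |C₂|`. -/
def MonotoneSketch {𝒰 T : Type*} (S : Set 𝒰 → T) : Prop :=
  ∀ A U₁ U₂ C₁ C₂ : Set 𝒰, U₁ ⊆ U₂ →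
    (C₁ ⊆ U₁ ∧ S (C₁ ∪ A) = S (U₁ ∪ A) ∧
      ∀ C' : Set 𝒰, C' ⊂ C₁ → S (C' ∪ A) ≠ S (U₁ ∪ A)) →
    (C₂ ⊆ U₂ ∧ S (C₂ ∪ A) = S (U₂ ∪ A) ∧
      ∀ C' : Set 𝒰, C' ⊂ C₂ → S (C' ∪ A) ≠ S (U₂ ∪ A)) →
    C₁.ncard ≤ C₂.ncard

/-- Sets with equal sketches have a union with that same sketch. -/
theorem Composable.union_eq {𝒰 T : Type*} {S : Set 𝒰 → T} (hS : Composable S) {σ : T}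
    {V W : Set 𝒰} (hV : S V = σ) (hW : S W = σ) : S (V ∪ W) = σ := by
  obtain ⟨op, hop⟩ := hS
  rw [hop, hV, hW, ← hV, ← hop, Set.union_self]

/-- Any set between two sets with equal sketches has that same sketch. -/
theorem Composable.eq_of_subset_of_subset {𝒰 T : Type*} {S : Set 𝒰 → T} (hS : Composable S)
    {σ : T} {V D W : Set 𝒰} (hV : S V = σ) (hW : S W = σ) (hVD : V ⊆ D) (hDW : D ⊆ W) :
    S D = σ := by
  obtain ⟨op, hop⟩ := hS
  calc S D = S (D ∪ V) := by rw [Set.union_eq_left.mpr hVD]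
    _ = S (D ∪ W) := by rw [hop, hop, hV, hW]
    _ = σ := by rw [Set.union_eq_right.mpr hDW, hW]

/-- On a finite ground set, every set with sketch `σ` contains a core of `σ`. -/
theorem exists_isCore_subset {𝒰 T : Type*} [Finite 𝒰] {S : Set 𝒰 → T} {σ : T} {V : Set 𝒰}
    (hV : S V = σ) : ∃ C ⊆ V, IsCore S σ C := by
  obtain ⟨C, hCV, hC⟩ := (Set.toFinite {W : Set 𝒰 | S W = σ}).exists_le_minimal hV
  exact ⟨C, hCV, hC.prop, fun C' hC' h => hC.not_prop_of_lt hC' h⟩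

/-- A minimal residual core with respect to `A` is a minimal set completing the part of `A`
inside `U` to the sketch of `U`, for any `U` of sketch `σ` containing the underlying core. -/
theorem residual_minimal {𝒰 T : Type*} [Finite 𝒰] {S : Set 𝒰 → T} (hS : Composable S) {σ : T}
    {A C U : Set 𝒰} (hC : IsCore S σ C) (hCU : C ⊆ U) (hU : S U = σ)
    (hmin : Minimal (· ∈ (fun C => C \ A) '' {C : Set 𝒰 | IsCore S σ C}) (C \ A)) :
    C \ A ⊆ U ∧ S (C \ A ∪ A ∩ U) = S (U ∪ A ∩ U) ∧
      ∀ C' : Set 𝒰, C' ⊂ C \ A → S (C' ∪ A ∩ U) ≠ S (U ∪ A ∩ U) := by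
  have hsub : C \ A ⊆ U := Set.sdiff_subset.trans hCU
  rw [Set.union_eq_left.mpr Set.inter_subset_right, hU]
  refine ⟨hsub, ?_, fun C' hC' h => ?_⟩
  · refine hS.eq_of_subset_of_subset hC.1 hU (fun x hx => ?_)
      (Set.union_subset hsub Set.inter_subset_right)
    by_cases hA : x ∈ A
    · exact Or.inr ⟨hA, hCU hx⟩
    · exact Or.inl ⟨hx, hA⟩
  · obtain ⟨D, hD, hcore⟩ := exists_isCore_subset h
    have hDC' : D \ A ⊆ C' := fun x hx => (hD hx.1).resolve_right fun hxA => hx.2 hxA.1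
    exact hmin.not_prop_of_lt (lt_of_le_of_lt hDC' hC') ⟨D, hcore, rfl⟩

/-- For a monotone composable sketching map, all cores of a sketch value have
the same cardinality, and for every `A`, all minimal residual cores with
respect to `A` have the same cardinality. -/
theorem stmt7 {𝒰 T : Type*} [Fintype 𝒰] (S : Set 𝒰 → T) (hS : Composable S)
    (hmono : MonotoneSketch S) (σ : T) (hσ : σ ∈ Set.range S) :
    (∀ C₁ C₂ : Set 𝒰, IsCore S σ C₁ → IsCore S σ C₂ → C₁.ncard = C₂.ncard) ∧
    (∀ A X Y : Set 𝒰,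
      Minimal (· ∈ (fun C => C \ A) '' {C : Set 𝒰 | IsCore S σ C}) X →
      Minimal (· ∈ (fun C => C \ A) '' {C : Set 𝒰 | IsCore S σ C}) Y →
      X.ncard = Y.ncard) := by
  have key : ∀ A X Y : Set 𝒰,
      Minimal (· ∈ (fun C => C \ A) '' {C : Set 𝒰 | IsCore S σ C}) X →
      Minimal (· ∈ (fun C => C \ A) '' {C : Set 𝒰 | IsCore S σ C}) Y →
      X.ncard ≤ Y.ncard := by
    intro A X Y hX hY
    obtain ⟨C, hC, rfl⟩ := hX.prop
    obtain ⟨D, hD, rfl⟩ := hY.prop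
    have hU : S (C ∪ D) = σ := hS.union_eq hC.1 hD.1
    exact hmono (A ∩ (C ∪ D)) _ _ _ _ subset_rfl
      (residual_minimal hS hC Set.subset_union_left hU hX)
      (residual_minimal hS hD Set.subset_union_right hU hY)
  have minimal_of_core : ∀ C : Set 𝒰, IsCore S σ C →
      Minimal (· ∈ (fun C => C \ (∅ : Set 𝒰)) '' {C : Set 𝒰 | IsCore S σ C}) C := by
    refine fun C hC => ⟨⟨C, hC, Set.sdiff_empty⟩, ?_⟩
    rintro _ ⟨D, hD, rfl⟩ hDC
    simp only [Set.sdiff_empty] at hDC ⊢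
    by_contra hCD
    exact hC.2 D ⟨hDC, hCD⟩ hD.1
  exact ⟨fun C₁ C₂ h₁ h₂ =>
      (key ∅ C₁ C₂ (minimal_of_core C₁ h₁) (minimal_of_core C₂ h₂)).antisymm
        (key ∅ C₂ C₁ (minimal_of_core C₂ h₂) (minimal_of_core C₁ h₁)),
    fun A X Y hX hY => (key A X Y hX hY).antisymm (key A Y X hY hX)⟩
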